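/- arXiv:1408.6183 — 3 statements merged into one kernel-verified Lean document; each statement's English description precedes it below -/
import Mathlib

section
/- For every natural number n, the sums of crossings, of nestings, and of alignments over all perfect matchings of [2n] are equal; consequently each equals (1/3)·C(n,2)·(2n-1)!!, i.e. the average number of alignments over all M ∈ M_n is (1/3)·binom(n,2). -/
/-- `M` is a perfect matching of `{1, …, 2n}` (modeled on `Fin (2 * n)`):
a partition of the ground set into pairs. -/
def IsPerfectMatching (n : ℕ) (M : Finset (Finset (Fin (2 * n)))) : Prop :=
  (∀ p ∈ M, p.card = 2) ∧ ∀ i : Fin (2 * n), ∃! p, p ∈ M ∧ i ∈ p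

/-- The (ordered) pair of pairs `(p, q)` forms a crossing: `p = {a, b}`, `q = {c, d}` with
`a < c < b < d`.  Each unordered crossing `{p, q}` satisfies this in exactly one order. -/
def IsCrossing {m : ℕ} (p q : Finset (Fin m)) : Prop :=
  ∃ a b c d : Fin m, p = {a, b} ∧ q = {c, d} ∧ a < c ∧ c < b ∧ b < d

/-- `(p, q)` forms a nesting: `p = {a, b}`, `q = {c, d}` with `c < a < b < d`. -/
def IsNesting {m : ℕ} (p q : Finset (Fin m)) : Prop :=
  ∃ a b c d : Fin m, p = {a, b} ∧ q = {c, d} ∧ c < a ∧ a < b ∧ b < d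

/-- `(p, q)` forms an alignment: `p = {a, b}`, `q = {c, d}` with `a < b < c < d`. -/
def IsAlignment {m : ℕ} (p q : Finset (Fin m)) : Prop :=
  ∃ a b c d : Fin m, p = {a, b} ∧ q = {c, d} ∧ a < b ∧ b < c ∧ c < d

/-- `cr(M)`: the number of crossings of `M`. -/
noncomputable def crCount (n : ℕ) (M : Finset (Finset (Fin (2 * n)))) : ℕ :=
  Nat.card {pq : Finset (Fin (2 * n)) × Finset (Fin (2 * n)) //
    pq.1 ∈ M ∧ pq.2 ∈ M ∧ IsCrossing pq.1 pq.2}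

/-- `ne(M)`: the number of nestings of `M`. -/
noncomputable def neCount (n : ℕ) (M : Finset (Finset (Fin (2 * n)))) : ℕ :=
  Nat.card {pq : Finset (Fin (2 * n)) × Finset (Fin (2 * n)) //
    pq.1 ∈ M ∧ pq.2 ∈ M ∧ IsNesting pq.1 pq.2}

/-- `al(M)`: the number of alignments of `M`. -/
noncomputable def alCount (n : ℕ) (M : Finset (Finset (Fin (2 * n)))) : ℕ :=
  Nat.card {pq : Finset (Fin (2 * n)) × Finset (Fin (2 * n)) //
    pq.1 ∈ M ∧ pq.2 ∈ M ∧ IsAlignment pq.1 pq.2}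

open Finset in
theorem pair_eq_pair_of_lt {m : ℕ} {a b c d : Fin m} (hab : a < b) (hcd : c < d)
    (h : ({a, b} : Finset (Fin m)) = {c, d}) : a = c ∧ b = d := by
  have h1 : a ∈ ({c, d} : Finset (Fin m)) := h ▸ by simp
  have h2 : b ∈ ({c, d} : Finset (Fin m)) := h ▸ by simp
  have h3 : c ∈ ({a, b} : Finset (Fin m)) := h ▸ by simp
  simp only [mem_insert, mem_singleton] at h1 h2 h3
  grind

theorem exists_lt_of_card_eq_two {m : ℕ} {p : Finset (Fin m)} (hp : p.card = 2) :
    ∃ a b, a < b ∧ p = {a, b} := by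
  obtain ⟨a, b, hab, rfl⟩ := Finset.card_eq_two.1 hp
  rcases lt_or_gt_of_ne hab with h | h
  · exact ⟨a, b, h, rfl⟩
  · exact ⟨b, a, h, Finset.pair_comm a b⟩

open Classical in
/-- The finset of perfect matchings of `Fin (2 * n)`. -/
noncomputable def perfectMatchings (n : ℕ) : Finset (Finset (Finset (Fin (2 * n)))) :=
  Finset.univ.filter (IsPerfectMatching n)

theorem mem_perfectMatchings {n : ℕ} {M : Finset (Finset (Fin (2 * n)))} :
    M ∈ perfectMatchings n ↔ IsPerfectMatching n M := by
  simp [perfectMatchings]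

theorem finsum_isPerfectMatching (n : ℕ) (f : Finset (Finset (Fin (2 * n))) → ℕ) :
    (∑ᶠ M : {M : Finset (Finset (Fin (2 * n))) // IsPerfectMatching n M}, f M.1) =
      ∑ M ∈ perfectMatchings n, f M := by
  classical
  rw [finsum_eq_sum_of_fintype]
  exact (Finset.sum_subtype _ (fun _ => mem_perfectMatchings) f).symm

/-- Quadruples of elements of `Fin m` in increasing order. -/
def increasingQuads (m : ℕ) : Finset (Fin m × Fin m × Fin m × Fin m) :=
  Finset.univ.filter fun t => t.1 < t.2.1 ∧ t.2.1 < t.2.2.1 ∧ t.2.2.1 < t.2.2.2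

theorem mem_increasingQuads {m : ℕ} {a b c d : Fin m} :
    (a, b, c, d) ∈ increasingQuads m ↔ a < b ∧ b < c ∧ c < d := by
  simp [increasingQuads]

open Classical in
/-- The number of perfect matchings containing both `p` and `q`. -/
noncomputable def matchingsThrough (n : ℕ) (p q : Finset (Fin (2 * n))) : ℕ :=
  ((perfectMatchings n).filter fun M => p ∈ M ∧ q ∈ M).card

theorem sum_card_related (n : ℕ) (R : Finset (Fin (2 * n)) → Finset (Fin (2 * n)) → Prop)
    (f g : Fin (2 * n) × Fin (2 * n) × Fin (2 * n) × Fin (2 * n) → Finset (Fin (2 * n)))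
    (hR : ∀ p q, R p q ↔ ∃ t ∈ increasingQuads (2 * n), f t = p ∧ g t = q)
    (hinj : Set.InjOn (fun t => (f t, g t)) (increasingQuads (2 * n))) :
    (∑ M ∈ perfectMatchings n,
      Nat.card {pq : Finset (Fin (2 * n)) × Finset (Fin (2 * n)) //
        pq.1 ∈ M ∧ pq.2 ∈ M ∧ R pq.1 pq.2}) =
      ∑ t ∈ increasingQuads (2 * n), matchingsThrough n (f t) (g t) := by
  classical
  have key : ∀ M : Finset (Finset (Fin (2 * n))),
      Nat.card {pq : Finset (Fin (2 * n)) × Finset (Fin (2 * n)) //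
        pq.1 ∈ M ∧ pq.2 ∈ M ∧ R pq.1 pq.2} =
      ((increasingQuads (2 * n)).filter fun t => f t ∈ M ∧ g t ∈ M).card := by
    intro M
    rw [Nat.card_eq_fintype_card, Fintype.card_subtype]
    symm
    refine Finset.card_bij (fun t _ => (f t, g t)) ?_ ?_ ?_
    · intro t ht
      rw [Finset.mem_filter] at ht
      simp only [Finset.mem_filter, Finset.mem_univ, true_and]
      exact ⟨ht.2.1, ht.2.2, (hR _ _).2 ⟨t, ht.1, rfl, rfl⟩⟩
    · intro s hs t ht h
      exact hinj (Finset.mem_filter.1 hs).1 (Finset.mem_filter.1 ht).1 h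
    · rintro ⟨p, q⟩ h
      simp only [Finset.mem_filter, Finset.mem_univ, true_and] at h
      obtain ⟨t, ht, rfl, rfl⟩ := (hR _ _).1 h.2.2
      exact ⟨t, Finset.mem_filter.2 ⟨ht, h.1, h.2.1⟩, rfl⟩
  simp only [key, matchingsThrough]
  exact Finset.sum_card_bipartiteAbove_eq_sum_card_bipartiteBelow
    (fun M t => f t ∈ M ∧ g t ∈ M)

theorem sum_crCount (n : ℕ) : ∑ M ∈ perfectMatchings n, crCount n M =
    ∑ t ∈ increasingQuads (2 * n),
      matchingsThrough n {t.1, t.2.2.1} {t.2.1, t.2.2.2} := by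
  refine sum_card_related n IsCrossing _ _ (fun p q => ?_) ?_
  · constructor
    · rintro ⟨a, b, c, d, rfl, rfl, h1, h2, h3⟩
      exact ⟨(a, c, b, d), mem_increasingQuads.2 ⟨h1, h2, h3⟩, rfl, rfl⟩
    · rintro ⟨⟨a, c, b, d⟩, h, rfl, rfl⟩
      obtain ⟨h1, h2, h3⟩ := mem_increasingQuads.1 h
      exact ⟨a, b, c, d, rfl, rfl, h1, h2, h3⟩
  · rintro ⟨a, b, c, d⟩ h ⟨a', b', c', d'⟩ h' e
    obtain ⟨h1, h2, h3⟩ := mem_increasingQuads.1 h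
    obtain ⟨h1', h2', h3'⟩ := mem_increasingQuads.1 h'
    obtain ⟨e1, e2⟩ := Prod.mk.inj e
    obtain ⟨rfl, rfl⟩ := pair_eq_pair_of_lt (h1.trans h2) (h1'.trans h2') e1
    obtain ⟨rfl, rfl⟩ := pair_eq_pair_of_lt (h2.trans h3) (h2'.trans h3') e2
    rfl

theorem sum_neCount (n : ℕ) : ∑ M ∈ perfectMatchings n, neCount n M =
    ∑ t ∈ increasingQuads (2 * n),
      matchingsThrough n {t.2.1, t.2.2.1} {t.1, t.2.2.2} := by
  refine sum_card_related n IsNesting _ _ (fun p q => ?_) ?_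
  · constructor
    · rintro ⟨a, b, c, d, rfl, rfl, h1, h2, h3⟩
      exact ⟨(c, a, b, d), mem_increasingQuads.2 ⟨h1, h2, h3⟩, rfl, rfl⟩
    · rintro ⟨⟨c, a, b, d⟩, h, rfl, rfl⟩
      obtain ⟨h1, h2, h3⟩ := mem_increasingQuads.1 h
      exact ⟨a, b, c, d, rfl, rfl, h1, h2, h3⟩
  · rintro ⟨a, b, c, d⟩ h ⟨a', b', c', d'⟩ h' e
    obtain ⟨h1, h2, h3⟩ := mem_increasingQuads.1 h
    obtain ⟨h1', h2', h3'⟩ := mem_increasingQuads.1 h'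
    obtain ⟨e1, e2⟩ := Prod.mk.inj e
    obtain ⟨rfl, rfl⟩ := pair_eq_pair_of_lt h2 h2' e1
    obtain ⟨rfl, rfl⟩ :=
      pair_eq_pair_of_lt (h1.trans (h2.trans h3)) (h1'.trans (h2'.trans h3')) e2
    rfl

theorem sum_alCount (n : ℕ) : ∑ M ∈ perfectMatchings n, alCount n M =
    ∑ t ∈ increasingQuads (2 * n),
      matchingsThrough n {t.1, t.2.1} {t.2.2.1, t.2.2.2} := by
  refine sum_card_related n IsAlignment _ _ (fun p q => ?_) ?_
  · constructor
    · rintro ⟨a, b, c, d, rfl, rfl, h1, h2, h3⟩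
      exact ⟨(a, b, c, d), mem_increasingQuads.2 ⟨h1, h2, h3⟩, rfl, rfl⟩
    · rintro ⟨⟨a, b, c, d⟩, h, rfl, rfl⟩
      obtain ⟨h1, h2, h3⟩ := mem_increasingQuads.1 h
      exact ⟨a, b, c, d, rfl, rfl, h1, h2, h3⟩
  · rintro ⟨a, b, c, d⟩ h ⟨a', b', c', d'⟩ h' e
    obtain ⟨h1, h2, h3⟩ := mem_increasingQuads.1 h
    obtain ⟨h1', h2', h3'⟩ := mem_increasingQuads.1 h'
    obtain ⟨e1, e2⟩ := Prod.mk.inj e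
    obtain ⟨rfl, rfl⟩ := pair_eq_pair_of_lt h1 h1' e1
    obtain ⟨rfl, rfl⟩ := pair_eq_pair_of_lt h3 h3' e2
    rfl

theorem IsPerfectMatching.image_perm {n : ℕ} {M : Finset (Finset (Fin (2 * n)))}
    (hM : IsPerfectMatching n M) (σ : Equiv.Perm (Fin (2 * n))) :
    IsPerfectMatching n (M.image (Finset.image σ)) := by
  refine ⟨fun p hp => ?_, fun i => ?_⟩
  · obtain ⟨q, hq, rfl⟩ := Finset.mem_image.1 hp
    rw [Finset.card_image_of_injective _ σ.injective, hM.1 q hq]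
  · obtain ⟨p, ⟨hp, hip⟩, huniq⟩ := hM.2 (σ.symm i)
    refine ⟨p.image σ, ⟨Finset.mem_image_of_mem _ hp, ?_⟩, ?_⟩
    · exact Finset.mem_image.2 ⟨_, hip, by simp⟩
    · rintro q ⟨hq, hiq⟩
      obtain ⟨r, hr, rfl⟩ := Finset.mem_image.1 hq
      obtain ⟨j, hj, rfl⟩ := Finset.mem_image.1 hiq
      rw [huniq r ⟨hr, by simpa using hj⟩]

theorem matchingsThrough_image_perm (n : ℕ) (p q : Finset (Fin (2 * n)))
    (σ : Equiv.Perm (Fin (2 * n))) :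
    matchingsThrough n (p.image σ) (q.image σ) = matchingsThrough n p q := by
  have le : ∀ (τ : Equiv.Perm (Fin (2 * n))) (p q : Finset (Fin (2 * n))),
      matchingsThrough n p q ≤ matchingsThrough n (p.image τ) (q.image τ) := by
    intro τ p q
    refine Finset.card_le_card_of_injOn (fun M => M.image (Finset.image τ)) ?_ ?_
    · intro M hM
      simp only [Finset.coe_filter, Set.mem_ofPred_eq, mem_perfectMatchings] at hM ⊢
      exact ⟨hM.1.image_perm τ, Finset.mem_image_of_mem _ hM.2.1,
        Finset.mem_image_of_mem _ hM.2.2⟩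
    · exact (Finset.image_injective (Finset.image_injective τ.injective)).injOn
  refine le_antisymm ?_ (le σ p q)
  simpa [Finset.image_image] using le σ.symm (p.image σ) (q.image σ)

theorem sum_crCount_eq_sum_neCount (n : ℕ) :
    ∑ M ∈ perfectMatchings n, crCount n M = ∑ M ∈ perfectMatchings n, neCount n M := by
  rw [sum_crCount, sum_neCount]
  refine Finset.sum_congr rfl ?_
  rintro ⟨a, b, c, d⟩ h
  obtain ⟨h1, h2, h3⟩ := mem_increasingQuads.1 h
  rw [← matchingsThrough_image_perm n _ _ (Equiv.swap a b)]
  simp only [Finset.image_insert, Finset.image_singleton, Equiv.swap_apply_left,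
    Equiv.swap_apply_right]
  rw [Equiv.swap_apply_of_ne_of_ne (h1.trans h2).ne' h2.ne',
    Equiv.swap_apply_of_ne_of_ne (h1.trans (h2.trans h3)).ne' (h2.trans h3).ne']

theorem sum_crCount_eq_sum_alCount (n : ℕ) :
    ∑ M ∈ perfectMatchings n, crCount n M = ∑ M ∈ perfectMatchings n, alCount n M := by
  rw [sum_crCount, sum_alCount]
  refine Finset.sum_congr rfl ?_
  rintro ⟨a, b, c, d⟩ h
  obtain ⟨h1, h2, h3⟩ := mem_increasingQuads.1 h
  rw [← matchingsThrough_image_perm n _ _ (Equiv.swap b c)]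
  simp only [Finset.image_insert, Finset.image_singleton, Equiv.swap_apply_left,
    Equiv.swap_apply_right]
  rw [Equiv.swap_apply_of_ne_of_ne h1.ne (h1.trans h2).ne,
    Equiv.swap_apply_of_ne_of_ne (h2.trans h3).ne' h3.ne']

theorem IsPerfectMatching.disjoint {n : ℕ} {M : Finset (Finset (Fin (2 * n)))}
    (hM : IsPerfectMatching n M) {p q : Finset (Fin (2 * n))} (hp : p ∈ M) (hq : q ∈ M)
    (hpq : p ≠ q) : Disjoint p q :=
  Finset.disjoint_left.2 fun i hi hi' => hpq ((hM.2 i).unique ⟨hp, hi⟩ ⟨hq, hi'⟩)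

theorem IsPerfectMatching.card_eq {n : ℕ} {M : Finset (Finset (Fin (2 * n)))}
    (hM : IsPerfectMatching n M) : M.card = n := by
  have h1 : M.biUnion id = Finset.univ := by
    ext i
    obtain ⟨p, hp, -⟩ := hM.2 i
    simpa using ⟨p, hp⟩
  have h2 := Finset.card_biUnion (s := M) (t := id) fun p hp q hq => hM.disjoint hp hq
  have h3 : ∑ p ∈ M, (id p).card = M.card * 2 := Finset.sum_const_nat hM.1
  rw [h1, Finset.card_univ, Fintype.card_fin] at h2
  omega

theorem isCrossing_pair {m : ℕ} {a b c d : Fin m} (hab : a < b) (hcd : c < d) :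
    IsCrossing {a, b} {c, d} ↔ a < c ∧ c < b ∧ b < d := by
  constructor
  · rintro ⟨a', b', c', d', e, e', h1, h2, h3⟩
    obtain ⟨rfl, rfl⟩ := pair_eq_pair_of_lt hab (h1.trans h2) e
    obtain ⟨rfl, rfl⟩ := pair_eq_pair_of_lt hcd (h2.trans h3) e'
    exact ⟨h1, h2, h3⟩
  · rintro ⟨h1, h2, h3⟩
    exact ⟨a, b, c, d, rfl, rfl, h1, h2, h3⟩

theorem isNesting_pair {m : ℕ} {a b c d : Fin m} (hab : a < b) (hcd : c < d) :
    IsNesting {a, b} {c, d} ↔ c < a ∧ b < d := by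
  constructor
  · rintro ⟨a', b', c', d', e, e', h1, h2, h3⟩
    obtain ⟨rfl, rfl⟩ := pair_eq_pair_of_lt hab h2 e
    obtain ⟨rfl, rfl⟩ := pair_eq_pair_of_lt hcd (h1.trans (h2.trans h3)) e'
    exact ⟨h1, h3⟩
  · rintro ⟨h1, h3⟩
    exact ⟨a, b, c, d, rfl, rfl, h1, hab, h3⟩

theorem isAlignment_pair {m : ℕ} {a b c d : Fin m} (hab : a < b) (hcd : c < d) :
    IsAlignment {a, b} {c, d} ↔ b < c := by
  constructor
  · rintro ⟨a', b', c', d', e, e', h1, h2, h3⟩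
    obtain ⟨rfl, rfl⟩ := pair_eq_pair_of_lt hab h1 e
    obtain ⟨rfl, rfl⟩ := pair_eq_pair_of_lt hcd h3 e'
    exact h2
  · intro h
    exact ⟨a, b, c, d, rfl, rfl, hab, h, hcd⟩

theorem sup_val_pair {m : ℕ} {a b : Fin m} (hab : a < b) :
    ({a, b} : Finset (Fin m)).sup Fin.val = b.val := by
  have : a.val < b.val := hab
  simp; omega

theorem IsPerfectMatching.card_filter_sup_lt {n : ℕ} {M : Finset (Finset (Fin (2 * n)))}
    (hM : IsPerfectMatching n M) :
    ((M ×ˢ M).filter fun pq => pq.1.sup Fin.val < pq.2.sup Fin.val).card = n.choose 2 := by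
  set T := (M ×ˢ M).filter fun pq => pq.1.sup Fin.val < pq.2.sup Fin.val with hT
  set T' := (M ×ˢ M).filter fun pq => pq.2.sup Fin.val < pq.1.sup Fin.val with hT'
  have hswap : T.card = T'.card := by
    refine Finset.card_bij (fun pq _ => pq.swap) ?_ ?_ ?_
    · rintro ⟨p, q⟩ h
      simp only [hT, hT', Finset.mem_filter, Finset.mem_product, Prod.swap] at h ⊢
      tauto
    · intro x _ y _ h
      exact Prod.swap_injective h
    · rintro ⟨p, q⟩ h
      refine ⟨(q, p), ?_, rfl⟩
      simp only [hT, hT', Finset.mem_filter, Finset.mem_product] at h ⊢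
      tauto
  have hdisj : Disjoint T T' := by
    refine Finset.disjoint_left.2 fun x hx hx' => ?_
    exact lt_asymm (Finset.mem_filter.1 hx).2 (Finset.mem_filter.1 hx').2
  have hunion : T ∪ T' = M.offDiag := by
    ext ⟨p, q⟩
    simp only [hT, hT', Finset.mem_union, Finset.mem_filter, Finset.mem_product,
      Finset.mem_offDiag]
    constructor
    · rintro (⟨⟨hp, hq⟩, h⟩ | ⟨⟨hp, hq⟩, h⟩)
      · exact ⟨hp, hq, fun e => by simp [e] at h⟩
      · exact ⟨hp, hq, fun e => by simp [e] at h⟩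
    · rintro ⟨hp, hq, hne⟩
      have hd := hM.disjoint hp hq hne
      obtain ⟨a, b, hab, rfl⟩ := exists_lt_of_card_eq_two (hM.1 p hp)
      obtain ⟨c, d, hcd, rfl⟩ := exists_lt_of_card_eq_two (hM.1 q hq)
      rw [sup_val_pair hab, sup_val_pair hcd]
      have hbd : b ≠ d := fun e => Finset.disjoint_left.1 hd (by simp : b ∈ _) (by simp [e])
      rcases lt_or_gt_of_ne hbd with h | h
      · exact Or.inl ⟨⟨hp, hq⟩, h⟩
      · exact Or.inr ⟨⟨hp, hq⟩, h⟩
  have hcard := Finset.card_union_of_disjoint hdisj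
  rw [hunion, Finset.offDiag_card, hM.card_eq, ← hswap] at hcard
  rw [Nat.choose_two_right, Nat.mul_sub, mul_one, hcard]
  omega

theorem IsPerfectMatching.crCount_add_neCount_add_alCount {n : ℕ}
    {M : Finset (Finset (Fin (2 * n)))} (hM : IsPerfectMatching n M) :
    crCount n M + neCount n M + alCount n M = n.choose 2 := by
  classical
  have hfilter : ∀ R : Finset (Fin (2 * n)) → Finset (Fin (2 * n)) → Prop,
      Nat.card {pq : Finset (Fin (2 * n)) × Finset (Fin (2 * n)) //
        pq.1 ∈ M ∧ pq.2 ∈ M ∧ R pq.1 pq.2} =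
      ((M ×ˢ M).filter fun pq => R pq.1 pq.2).card := by
    intro R
    rw [Nat.card_eq_fintype_card, Fintype.card_subtype]
    congr 1
    ext x
    simp [and_assoc]
  rw [crCount, neCount, alCount, hfilter, hfilter, hfilter, ← hM.card_filter_sup_lt,
    ← Finset.card_union_of_disjoint, ← Finset.card_union_of_disjoint]
  · congr 1
    ext ⟨p, q⟩
    simp only [Finset.mem_union, Finset.mem_filter, Finset.mem_product, ← and_or_left]
    refine and_congr_right fun ⟨hp, hq⟩ => ?_
    by_cases hne : p = q
    · subst hne
      obtain ⟨a, b, hab, rfl⟩ := exists_lt_of_card_eq_two (hM.1 p hp)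
      rw [isCrossing_pair hab hab, isNesting_pair hab hab, isAlignment_pair hab hab]
      grind
    · have hd := hM.disjoint hp hq hne
      obtain ⟨a, b, hab, rfl⟩ := exists_lt_of_card_eq_two (hM.1 p hp)
      obtain ⟨c, d, hcd, rfl⟩ := exists_lt_of_card_eq_two (hM.1 q hq)
      rw [isCrossing_pair hab hcd, isNesting_pair hab hcd, isAlignment_pair hab hcd,
        sup_val_pair hab, sup_val_pair hcd, Fin.val_fin_lt]
      have hac : a ≠ c := fun e => Finset.disjoint_left.1 hd (by simp : a ∈ _) (by simp [e])
      have hbc : b ≠ c := fun e => Finset.disjoint_left.1 hd (by simp : b ∈ _) (by simp [e])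
      grind
  · refine Finset.disjoint_left.2 ?_
    rintro ⟨p, q⟩ h h'
    simp only [Finset.mem_union, Finset.mem_filter, Finset.mem_product] at h h'
    obtain ⟨a, b, hab, rfl⟩ := exists_lt_of_card_eq_two (hM.1 p h'.1.1)
    obtain ⟨c, d, hcd, rfl⟩ := exists_lt_of_card_eq_two (hM.1 q h'.1.2)
    rw [isCrossing_pair hab hcd, isNesting_pair hab hcd, isAlignment_pair hab hcd] at *
    grind
  · refine Finset.disjoint_left.2 ?_
    rintro ⟨p, q⟩ h h'
    simp only [Finset.mem_filter, Finset.mem_product] at h h'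
    obtain ⟨a, b, hab, rfl⟩ := exists_lt_of_card_eq_two (hM.1 p h'.1.1)
    obtain ⟨c, d, hcd, rfl⟩ := exists_lt_of_card_eq_two (hM.1 q h'.1.2)
    rw [isCrossing_pair hab hcd] at h
    rw [isNesting_pair hab hcd] at h'
    grind

theorem cycleType_eq_replicate_two_iff {n : ℕ} (f : Equiv.Perm (Fin (2 * n))) :
    f.cycleType = Multiset.replicate n 2 ↔ (∀ i, f (f i) = i) ∧ ∀ i, f i ≠ i := by
  constructor
  · intro h
    have hsupp : f.support = Finset.univ := by
      rw [← Finset.card_eq_iff_eq_univ, ← Equiv.Perm.sum_cycleType, h]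
      simp [mul_comm]
    have hord : f ^ 2 = 1 := by
      rw [← orderOf_dvd_iff_pow_eq_one, ← Equiv.Perm.lcm_cycleType, h, Multiset.lcm_dvd]
      intro b hb
      rw [Multiset.eq_of_mem_replicate hb]
    refine ⟨fun i => ?_, fun i => ?_⟩
    · rw [← Equiv.Perm.mul_apply, ← sq, hord, Equiv.Perm.one_apply]
    · rw [← Equiv.Perm.mem_support, hsupp]
      exact Finset.mem_univ i
  · rintro ⟨hinv, hfix⟩
    have hsupp : f.support = Finset.univ := by
      ext i
      simpa using hfix i
    have hord : f ^ 2 = 1 := by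
      ext i
      rw [sq, Equiv.Perm.mul_apply, hinv, Equiv.Perm.one_apply]
    have htwo : ∀ b ∈ f.cycleType, b = 2 := fun b hb =>
      le_antisymm (Nat.le_of_dvd two_pos
        ((Equiv.Perm.dvd_of_mem_cycleType hb).trans (orderOf_dvd_iff_pow_eq_one.2 hord)))
        (Equiv.Perm.two_le_of_mem_cycleType hb)
    have hrep := Multiset.eq_replicate_card.2 htwo
    have hsum := Equiv.Perm.sum_cycleType f
    rw [hrep, hsupp] at hsum
    simp at hsum
    rw [hrep, show f.cycleType.card = n by omega]

theorem isPerfectMatching_image_pair {n : ℕ} {f : Equiv.Perm (Fin (2 * n))}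
    (hinv : ∀ i, f (f i) = i) (hfix : ∀ i, f i ≠ i) :
    IsPerfectMatching n (Finset.univ.image fun i => {i, f i}) := by
  refine ⟨fun p hp => ?_, fun i => ⟨{i, f i}, ⟨by simp, by simp⟩, ?_⟩⟩
  · obtain ⟨i, -, rfl⟩ := Finset.mem_image.1 hp
    exact Finset.card_pair (hfix i).symm
  · rintro q ⟨hq, hi⟩
    obtain ⟨j, -, rfl⟩ := Finset.mem_image.1 hq
    rcases Finset.mem_insert.1 hi with rfl | h
    · rfl
    · rw [Finset.mem_singleton.1 h, hinv, Finset.pair_comm]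

theorem IsPerfectMatching.exists_perm {n : ℕ} {M : Finset (Finset (Fin (2 * n)))}
    (hM : IsPerfectMatching n M) :
    ∃ f : Equiv.Perm (Fin (2 * n)), (∀ i, f (f i) = i) ∧ (∀ i, f i ≠ i) ∧
      (Finset.univ.image fun i => {i, f i}) = M := by
  have hpartner : ∀ i, ∃ j, j ≠ i ∧ ({i, j} : Finset (Fin (2 * n))) ∈ M := by
    intro i
    obtain ⟨p, ⟨hp, hi⟩, -⟩ := hM.2 i
    obtain ⟨a, b, hab, rfl⟩ := Finset.card_eq_two.1 (hM.1 p hp)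
    simp only [Finset.mem_insert, Finset.mem_singleton] at hi
    rcases hi with rfl | rfl
    · exact ⟨b, hab.symm, hp⟩
    · exact ⟨a, hab, by rwa [Finset.pair_comm]⟩
  choose g hne hg using hpartner
  have hinv : Function.Involutive g := by
    intro i
    have h := (hM.2 (g i)).unique ⟨hg (g i), by simp⟩ ⟨hg i, by simp⟩
    have h' : g (g i) ∈ ({i, g i} : Finset (Fin (2 * n))) := h ▸ by simp
    simpa [hne] using h'
  refine ⟨hinv.toPerm, hinv, hne, ?_⟩
  ext p
  simp only [Finset.mem_image, Finset.mem_univ, true_and, Function.Involutive.coe_toPerm]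
  constructor
  · rintro ⟨i, rfl⟩
    exact hg i
  · intro hp
    obtain ⟨a, b, -, rfl⟩ := Finset.card_eq_two.1 (hM.1 p hp)
    exact ⟨a, (hM.2 a).unique ⟨hg a, by simp⟩ ⟨hp, by simp⟩⟩

theorem card_perfectMatchings (n : ℕ) :
    (perfectMatchings n).card = Nat.doubleFactorial (2 * n - 1) := by
  have hbij : (Finset.univ.filter fun f : Equiv.Perm (Fin (2 * n)) =>
      f.cycleType = Multiset.replicate n 2).card = (perfectMatchings n).card := by
    refine Finset.card_bij (fun f _ => Finset.univ.image fun i => {i, f i}) ?_ ?_ ?_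
    · intro f hf
      obtain ⟨hinv, hfix⟩ := (cycleType_eq_replicate_two_iff f).1 (Finset.mem_filter.1 hf).2
      exact mem_perfectMatchings.2 (isPerfectMatching_image_pair hinv hfix)
    · intro f hf g hg h
      obtain ⟨-, hfix⟩ := (cycleType_eq_replicate_two_iff f).1 (Finset.mem_filter.1 hf).2
      obtain ⟨hinv', hfix'⟩ := (cycleType_eq_replicate_two_iff g).1 (Finset.mem_filter.1 hg).2
      ext i : 1
      have hi : ({i, f i} : Finset (Fin (2 * n))) ∈ Finset.univ.image fun i => {i, g i} :=
        h ▸ Finset.mem_image_of_mem (fun i => ({i, f i} : Finset (Fin (2 * n))))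
          (Finset.mem_univ i)
      have e := ((isPerfectMatching_image_pair hinv' hfix').2 i).unique ⟨hi, by simp⟩
        ⟨Finset.mem_image_of_mem (fun i => ({i, g i} : Finset (Fin (2 * n))))
          (Finset.mem_univ i), by simp⟩
      have h' : f i ∈ ({i, g i} : Finset (Fin (2 * n))) := e ▸ by simp
      simpa [hfix] using h'
    · intro M hM
      obtain ⟨f, hinv, hfix, rfl⟩ := (mem_perfectMatchings.1 hM).exists_perm
      exact ⟨f, Finset.mem_filter.2 ⟨Finset.mem_univ f,
        (cycleType_eq_replicate_two_iff f).2 ⟨hinv, hfix⟩⟩, rfl⟩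
  rw [← hbij]
  rcases n with _ | n
  · decide
  · rw [Equiv.Perm.card_of_cycleType, if_pos]
    · have hfac : (2 * (n + 1)).factorial =
          (2 ^ (n + 1) * (n + 1).factorial) * Nat.doubleFactorial (2 * (n + 1) - 1) := by
        rw [← Nat.doubleFactorial_two_mul]
        exact Nat.factorial_eq_mul_doubleFactorial (2 * n + 1)
      have hset : (Multiset.replicate (n + 1) 2).toFinset = {2} := by
        rw [Multiset.toFinset_replicate, if_neg n.succ_ne_zero]
      simp only [hset, Multiset.sum_replicate, Multiset.prod_replicate, Fintype.card_fin,
        Finset.prod_singleton, Multiset.count_replicate_self, smul_eq_mul]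
      rw [mul_comm (n + 1) 2, Nat.sub_self, Nat.factorial_zero, one_mul, hfac]
      exact Nat.mul_div_cancel_left _ (by positivity)
    · refine ⟨by simp; omega, fun a ha => ?_⟩
      rw [Multiset.eq_of_mem_replicate ha]

/-- The sums of crossings, nestings and alignments over all perfect matchings of `[2n]` are
equal, and consequently each equals `(1/3)·C(n, 2)·(2n - 1)!!` (stated with the denominator
cleared: three times the total number of alignments is `C(n, 2)·(2n - 1)!!`, i.e. the average
number of alignments over `M_n` is `C(n, 2)/3`, since `#M_n = (2n - 1)!!`). -/
theorem equidistribution_of_crossings_nestings_alignments (n : ℕ) :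
    (∑ᶠ M : {M : Finset (Finset (Fin (2 * n))) // IsPerfectMatching n M}, crCount n M.1) =
        (∑ᶠ M : {M : Finset (Finset (Fin (2 * n))) // IsPerfectMatching n M}, neCount n M.1) ∧
      (∑ᶠ M : {M : Finset (Finset (Fin (2 * n))) // IsPerfectMatching n M}, neCount n M.1) =
        (∑ᶠ M : {M : Finset (Finset (Fin (2 * n))) // IsPerfectMatching n M}, alCount n M.1) ∧
      3 * (∑ᶠ M : {M : Finset (Finset (Fin (2 * n))) // IsPerfectMatching n M}, alCount n M.1) =
        n.choose 2 * Nat.doubleFactorial (2 * n - 1) := by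
  simp only [finsum_isPerfectMatching]
  refine ⟨sum_crCount_eq_sum_neCount n,
    (sum_crCount_eq_sum_neCount n).symm.trans (sum_crCount_eq_sum_alCount n), ?_⟩
  have htotal : ∑ M ∈ perfectMatchings n, (crCount n M + neCount n M + alCount n M) =
      n.choose 2 * Nat.doubleFactorial (2 * n - 1) := by
    rw [Finset.sum_congr rfl fun M hM =>
      (mem_perfectMatchings.1 hM).crCount_add_neCount_add_alCount]
    rw [Finset.sum_const, card_perfectMatchings, smul_eq_mul, mul_comm]
  rw [← htotal, Finset.sum_add_distrib, Finset.sum_add_distrib, ← sum_crCount_eq_sum_neCount,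
    ← sum_crCount_eq_sum_alCount]
  ring
end

section
/- For every natural number n and all natural numbers a, b, c, the number of perfect matchings M of [2n] with cr(M) = a, ne(M) = b, al(M) = c equals the number of perfect matchings M of [2n] with cr(M) = b, ne(M) = a, al(M) = c. That is, the joint distribution of (cr, ne, al) over M_n is symmetric under exchanging crossings and nestings. -/
open Finset

/-! ### Permutations below a staircase -/

/-- The number of pairs of indices satisfying `R`. -/
noncomputable def pairCount {n : ℕ} (R : Fin n → Fin n → Prop) : ℕ :=
  open Classical in ∑ i, ∑ j, if R i j then 1 else 0

theorem natCard_pairs {n : ℕ} (R : Fin n → Fin n → Prop) :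
    Nat.card {x : Fin n × Fin n // R x.1 x.2} = pairCount R := by
  classical
  rw [Nat.card_eq_fintype_card, Fintype.card_subtype, Finset.card_filter, Fintype.sum_prod_type]
  simp only [pairCount]

theorem pairCount_succ {n : ℕ} (R : Fin (n + 1) → Fin (n + 1) → Prop)
    (h : ∀ i, ¬ R i 0) :
    pairCount R = Nat.card {j : Fin n // R 0 j.succ} +
      pairCount fun i j => R (Fin.succ i) (Fin.succ j) := by
  classical
  rw [Nat.card_eq_fintype_card, Fintype.card_subtype, Finset.card_filter, pairCount,
    Fin.sum_univ_succ]
  simp only [Fin.sum_univ_succ, h, if_false, zero_add, pairCount]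

/-- The permutation with first value `k` whose remaining values are ordered as those of `τ`. -/
noncomputable def permCons {n : ℕ} (x : Fin (n + 1) × Equiv.Perm (Fin n)) :
    Equiv.Perm (Fin (n + 1)) :=
  Equiv.ofBijective (Fin.cons x.1 fun j => x.1.succAbove (x.2 j)) <| by
    refine Finite.injective_iff_bijective.1 (Fin.cons_injective_iff.2 ⟨?_, ?_⟩)
    · rintro ⟨j, hj⟩
      exact Fin.succAbove_ne _ _ hj
    · exact Fin.succAbove_right_injective.comp x.2.injective

@[simp] theorem permCons_zero {n : ℕ} (x : Fin (n + 1) × Equiv.Perm (Fin n)) :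
    permCons x 0 = x.1 := rfl

@[simp] theorem permCons_succ {n : ℕ} (x : Fin (n + 1) × Equiv.Perm (Fin n)) (j : Fin n) :
    permCons x j.succ = x.1.succAbove (x.2 j) := rfl

theorem permCons_bijective {n : ℕ} : Function.Bijective (permCons (n := n)) := by
  refine (Fintype.bijective_iff_injective_and_card _).2 ⟨?_, ?_⟩
  · rintro ⟨k, τ⟩ ⟨l, ρ⟩ h
    obtain rfl : k = l := by simpa using congrArg (fun σ => σ 0) h
    refine Prod.ext rfl (Equiv.ext fun j => ?_)
    have := congrArg (fun σ => σ j.succ) h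
    simpa using this
  · simp [Fintype.card_perm, Nat.factorial_succ]

/-- Inversions of `σ`. -/
noncomputable def invCount {n : ℕ} (σ : Equiv.Perm (Fin n)) : ℕ :=
  pairCount fun i j => i < j ∧ σ j < σ i

/-- Non-inversions `i < j` of `σ` with `σ j` below the bound `h i`. -/
noncomputable def boundedNoninvCount {n : ℕ} (h : Fin n → ℕ) (σ : Equiv.Perm (Fin n)) : ℕ :=
  pairCount fun i j => i < j ∧ σ i < σ j ∧ (σ j : ℕ) < h i

theorem natCard_comp_perm {n : ℕ} (τ : Equiv.Perm (Fin n)) (P : Fin n → Prop) :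
    Nat.card {j // P (τ j)} = Nat.card {t // P t} :=
  Nat.card_congr (τ.subtypeEquiv fun _ => Iff.rfl)

theorem natCard_fin_interval {n a b : ℕ} (hb : b ≤ n) :
    Nat.card {t : Fin n // a ≤ (t : ℕ) ∧ (t : ℕ) < b} = b - a := by
  rw [← Nat.card_Ico a b, ← Nat.card_eq_finsetCard]
  exact Nat.card_congr
    { toFun := fun t => ⟨t.1, mem_Ico.2 t.2⟩
      invFun := fun t => ⟨⟨t.1, (mem_Ico.1 t.2).2.trans_le hb⟩, mem_Ico.1 t.2⟩ }

theorem invCount_permCons {n : ℕ} (k : Fin (n + 1)) (τ : Equiv.Perm (Fin n)) :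
    invCount (permCons (k, τ)) = k + invCount τ := by
  rw [invCount, pairCount_succ _ (by simp)]
  simp only [permCons_zero, permCons_succ, Fin.succ_pos, true_and, Fin.succ_lt_succ_iff,
    Fin.succAbove_lt_succAbove_iff]
  rw [natCard_comp_perm τ (fun t => k.succAbove t < k), ← invCount]
  congr 1
  rw [← Nat.sub_zero (k : ℕ), ← natCard_fin_interval (n := n) (a := 0) (b := k) (by omega)]
  refine Nat.card_congr (Equiv.subtypeEquivRight fun t => ?_)
  rw [Fin.succAbove_lt_iff_castSucc_lt, Fin.lt_def]
  simp

theorem boundedNoninvCount_permCons {n : ℕ} (h : Fin (n + 1) → ℕ) (hn : ∀ i, h i ≤ n + 1)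
    (hm : Monotone h) (k : Fin (n + 1)) (hk : k < h 0) (τ : Equiv.Perm (Fin n)) :
    boundedNoninvCount h (permCons (k, τ)) =
      (h 0 - 1 - k) + boundedNoninvCount (fun j => h j.succ - 1) τ := by
  have key : ∀ (i : Fin (n + 1)) (t : Fin n),
      ((k.succAbove t : Fin (n + 1)) : ℕ) < h i ↔ (t : ℕ) < h i - 1 := by
    intro i t
    have := hm (Fin.zero_le i)
    simp only [Fin.succAbove, Fin.lt_def]
    split_ifs with hs <;> simp at hs ⊢ <;> omega
  rw [boundedNoninvCount, pairCount_succ _ (by simp)]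
  simp only [permCons_zero, permCons_succ, Fin.succ_pos, true_and, Fin.succ_lt_succ_iff,
    Fin.succAbove_lt_succAbove_iff, key]
  rw [natCard_comp_perm τ (fun t => k < k.succAbove t ∧ (t : ℕ) < h 0 - 1), ← boundedNoninvCount]
  congr 1
  have := hn 0
  rw [← natCard_fin_interval (n := n) (a := k) (b := h 0 - 1) (by omega)]
  refine Nat.card_congr (Equiv.subtypeEquivRight fun t => ?_)
  rw [Fin.lt_succAbove_iff_le_castSucc, Fin.le_def]
  simp

theorem permCons_bounded_iff {n : ℕ} (h : Fin (n + 1) → ℕ) (hm : Monotone h)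
    (k : Fin (n + 1)) (τ : Equiv.Perm (Fin n)) :
    (∀ i, (permCons (k, τ) i : ℕ) < h i) ↔ k < h 0 ∧ ∀ j, (τ j : ℕ) < h j.succ - 1 := by
  rw [Fin.forall_fin_succ, permCons_zero]
  refine and_congr_right fun (hk : (k : ℕ) < h 0) => forall_congr' fun j => ?_
  have := hm (Fin.zero_le j.succ)
  simp only [permCons_succ, Fin.succAbove, Fin.lt_def]
  split_ifs with hs <;> simp at hs ⊢ <;> omega

/-- Among the permutations bounded by a staircase, inversions and bounded non-inversions can be
exchanged by an involution. -/
theorem exists_involution_swap_inv {n : ℕ} (h : Fin n → ℕ) (hn : ∀ i, h i ≤ n)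
    (hm : Monotone h) :
    ∃ Φ : Equiv.Perm (Fin n) → Equiv.Perm (Fin n), Function.Involutive Φ ∧
      ∀ σ, (∀ i, (σ i : ℕ) < h i) →
        (∀ i, (Φ σ i : ℕ) < h i) ∧ invCount (Φ σ) = boundedNoninvCount h σ := by
  induction n with
  | zero => exact ⟨id, fun _ => rfl, fun σ _ => by simp [invCount, boundedNoninvCount, pairCount]⟩
  | succ n ih =>
    obtain ⟨Φ, hΦ, hΦ'⟩ := ih (fun j => h j.succ - 1)
      (fun j => by have := hn j.succ; omega)
      (fun i j hij => Nat.sub_le_sub_right (hm (Fin.succ_le_succ_iff.2 hij)) 1)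
    let e := Equiv.ofBijective _ (permCons_bijective (n := n))
    let r : Fin (n + 1) → Fin (n + 1) := fun k =>
      if hk : k < h 0 then ⟨h 0 - 1 - k, by have := hn 0; omega⟩ else k
    have hr : Function.Involutive r := by
      intro k
      simp only [r]
      by_cases hk : k < h 0
      · have : h 0 - 1 - k < h 0 := by omega
        ext
        simp only [hk, this, dite_true]
        omega
      · simp [hk]
    refine ⟨fun σ => e (Prod.map r Φ (e.symm σ)), fun σ => ?_, fun σ hσ => ?_⟩
    · simp [hr.prodMap hΦ _]
    · obtain ⟨⟨k, τ⟩, rfl⟩ := e.surjective σ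
      obtain ⟨hk, hτ⟩ := (permCons_bounded_iff h hm k τ).1 hσ
      have hrk : (r k : ℕ) = h 0 - 1 - k := by simp [r, hk]
      obtain ⟨h₁, h₂⟩ := hΦ' τ hτ
      simp only [e.symm_apply_apply]
      exact ⟨(permCons_bounded_iff h hm _ _).2 ⟨by omega, h₁⟩, by
        simp only [e, Equiv.ofBijective_apply, Prod.map_apply, invCount_permCons,
          boundedNoninvCount_permCons h hn hm k hk, h₂, hrk]⟩

/-! ### Matchings as permutations -/

/-- The `i`-th element of `C`, the set of larger endpoints. -/
def closer {n : ℕ} (C : {C : Finset (Fin (2 * n)) // C.card = n}) : Fin n ↪o Fin (2 * n) :=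
  C.1.orderEmbOfFin C.2

/-- The `i`-th element of the complement of `C`, the set of smaller endpoints. -/
def opener {n : ℕ} (C : {C : Finset (Fin (2 * n)) // C.card = n}) : Fin n ↪o Fin (2 * n) :=
  (C.1ᶜ).orderEmbOfFin (by rw [card_compl, C.2, Fintype.card_fin]; omega)

section

variable {n : ℕ} (C : {C : Finset (Fin (2 * n)) // C.card = n})

theorem mem_iff_exists_closer {x : Fin (2 * n)} : x ∈ C.1 ↔ ∃ i, closer C i = x := by
  rw [← Finset.mem_coe, ← Finset.range_orderEmbOfFin C.1 C.2]
  rfl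

theorem notMem_iff_exists_opener {x : Fin (2 * n)} : x ∉ C.1 ↔ ∃ i, opener C i = x := by
  rw [← Finset.mem_compl, ← Finset.mem_coe, ← Finset.range_orderEmbOfFin C.1ᶜ]
  rfl

theorem opener_ne_closer (i j : Fin n) : opener C i ≠ closer C j := fun h =>
  (notMem_iff_exists_opener C).2 ⟨i, h⟩ ((mem_iff_exists_closer C).2 ⟨j, rfl⟩)

/-- The pair of endpoints whose larger element is `closer C i`. -/
def arc (σ : Equiv.Perm (Fin n)) (i : Fin n) : Finset (Fin (2 * n)) :=
  {opener C (σ i), closer C i}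

/-- The matching of `closer C i` with `opener C (σ i)`. -/
def arcs (σ : Equiv.Perm (Fin n)) : Finset (Finset (Fin (2 * n))) := univ.image (arc C σ)

theorem closer_mem_arc {σ : Equiv.Perm (Fin n)} {i j : Fin n} :
    closer C j ∈ arc C σ i ↔ i = j := by
  simp [arc, (opener_ne_closer C _ _).symm, eq_comm]

theorem opener_mem_arc {σ : Equiv.Perm (Fin n)} {i j : Fin n} :
    opener C j ∈ arc C σ i ↔ σ i = j := by
  simp [arc, opener_ne_closer C, eq_comm]

theorem arc_injective (σ : Equiv.Perm (Fin n)) : Function.Injective (arc C σ) := fun i j h => by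
  rw [← closer_mem_arc C (σ := σ), h, closer_mem_arc]

theorem isPerfectMatching_arcs (σ : Equiv.Perm (Fin n)) : IsPerfectMatching n (arcs C σ) := by
  refine ⟨?_, fun x => ?_⟩
  · simp only [arcs, mem_image, mem_univ, true_and]
    rintro _ ⟨i, rfl⟩
    exact card_pair (opener_ne_closer C _ _)
  · simp only [arcs, mem_image, mem_univ, true_and]
    by_cases hx : x ∈ C.1
    · obtain ⟨i, rfl⟩ := (mem_iff_exists_closer C).1 hx
      refine ⟨arc C σ i, ⟨⟨i, rfl⟩, (closer_mem_arc C).2 rfl⟩, ?_⟩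
      rintro _ ⟨⟨j, rfl⟩, hj⟩
      rw [(closer_mem_arc C).1 hj]
    · obtain ⟨i, rfl⟩ := (notMem_iff_exists_opener C).1 hx
      refine ⟨arc C σ (σ.symm i), ⟨⟨_, rfl⟩, (opener_mem_arc C).2 (by simp)⟩, ?_⟩
      rintro _ ⟨⟨j, rfl⟩, hj⟩
      rw [← (opener_mem_arc C).1 hj, Equiv.symm_apply_apply]

theorem pair_eq_pair_of_lt_s15 {α : Type*} [LinearOrder α] {x y a b : α} (hxy : x < y)
    (hab : a < b) : ({x, y} : Finset α) = {a, b} ↔ x = a ∧ y = b := by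
  refine ⟨fun h => ?_, by rintro ⟨rfl, rfl⟩; rfl⟩
  have h' : s(x, y) = s(a, b) := by
    rw [← Finset.coe_inj] at h
    simp only [coe_insert, coe_singleton, Set.pair_eq_pair_iff] at h
    exact Sym2.eq_iff.2 h
  rcases Sym2.eq_iff.1 h' with h | ⟨rfl, rfl⟩
  · exact h
  · exact absurd hxy hab.asymm

theorem pair_mem_arcs {σ : Equiv.Perm (Fin n)} (hσ : ∀ i, opener C (σ i) < closer C i)
    {x y : Fin (2 * n)} (hxy : x < y) :
    {x, y} ∈ arcs C σ ↔ ∃ i, opener C (σ i) = x ∧ closer C i = y := by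
  simp only [arcs, arc, mem_image, mem_univ, true_and, pair_eq_pair_of_lt_s15 (hσ _) hxy]

theorem mem_iff_exists_pair_mem_arcs {σ : Equiv.Perm (Fin n)}
    (hσ : ∀ i, opener C (σ i) < closer C i) (y : Fin (2 * n)) :
    y ∈ C.1 ↔ ∃ x < y, {x, y} ∈ arcs C σ := by
  rw [mem_iff_exists_closer]
  constructor
  · rintro ⟨i, rfl⟩
    exact ⟨_, hσ i, (pair_mem_arcs C hσ (hσ i)).2 ⟨i, rfl, rfl⟩⟩
  · rintro ⟨x, hx, h⟩
    obtain ⟨i, -, hi⟩ := (pair_mem_arcs C hσ hx).1 h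
    exact ⟨i, hi⟩

theorem natCard_arcs_pairs (σ : Equiv.Perm (Fin n))
    (R : Finset (Fin (2 * n)) → Finset (Fin (2 * n)) → Prop) :
    Nat.card {pq : Finset (Fin (2 * n)) × Finset (Fin (2 * n)) //
      pq.1 ∈ arcs C σ ∧ pq.2 ∈ arcs C σ ∧ R pq.1 pq.2} =
      pairCount fun i j => R (arc C σ i) (arc C σ j) := by
  rw [← natCard_pairs]
  symm
  refine Nat.card_congr (Equiv.ofBijective (fun x => ⟨(arc C σ x.1.1, arc C σ x.1.2),
    mem_image_of_mem _ (mem_univ _), mem_image_of_mem _ (mem_univ _), x.2⟩) ⟨?_, ?_⟩)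
  · rintro ⟨⟨i, j⟩, _⟩ ⟨⟨k, l⟩, _⟩ h
    simp only [Subtype.mk.injEq, Prod.mk.injEq] at h
    simp [arc_injective C σ h.1, arc_injective C σ h.2]
  · rintro ⟨⟨p, q⟩, hp, hq, h⟩
    obtain ⟨i, -, rfl⟩ := mem_image.1 hp
    obtain ⟨j, -, rfl⟩ := mem_image.1 hq
    exact ⟨⟨(i, j), h⟩, rfl⟩

section

variable {m : ℕ} {x y z w : Fin m}

theorem isCrossing_pair_iff (hxy : x < y) (hzw : z < w) :
    IsCrossing {x, y} {z, w} ↔ x < z ∧ z < y ∧ y < w := by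
  refine ⟨?_, fun h => ⟨x, y, z, w, rfl, rfl, h⟩⟩
  rintro ⟨a, b, c, d, h₁, h₂, h⟩
  obtain ⟨rfl, rfl⟩ := (pair_eq_pair_of_lt_s15 hxy (h.1.trans h.2.1)).1 h₁
  obtain ⟨rfl, rfl⟩ := (pair_eq_pair_of_lt_s15 hzw (h.2.1.trans h.2.2)).1 h₂
  exact h

theorem isNesting_pair_iff (hxy : x < y) (hzw : z < w) :
    IsNesting {x, y} {z, w} ↔ z < x ∧ y < w := by
  refine ⟨?_, fun h => ⟨x, y, z, w, rfl, rfl, h.1, hxy, h.2⟩⟩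
  rintro ⟨a, b, c, d, h₁, h₂, h⟩
  obtain ⟨rfl, rfl⟩ := (pair_eq_pair_of_lt_s15 hxy h.2.1).1 h₁
  obtain ⟨rfl, rfl⟩ := (pair_eq_pair_of_lt_s15 hzw (h.1.trans (h.2.1.trans h.2.2))).1 h₂
  exact ⟨h.1, h.2.2⟩

theorem isAlignment_pair_iff (hxy : x < y) (hzw : z < w) :
    IsAlignment {x, y} {z, w} ↔ y < z := by
  refine ⟨?_, fun h => ⟨x, y, z, w, rfl, rfl, hxy, h, hzw⟩⟩
  rintro ⟨a, b, c, d, h₁, h₂, h⟩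
  obtain ⟨rfl, rfl⟩ := (pair_eq_pair_of_lt_s15 hxy h.1).1 h₁
  obtain ⟨rfl, rfl⟩ := (pair_eq_pair_of_lt_s15 hzw h.2.2).1 h₂
  exact h.2.1

end

/-- The number of smaller endpoints preceding `closer C i`. -/
def height (i : Fin n) : ℕ := #{k | opener C k < closer C i}

theorem lt_height_iff (k i : Fin n) : k < height C i ↔ opener C k < closer C i := by
  constructor
  · contrapose!
    intro h
    rw [height, ← Fin.card_Iio k]
    refine card_le_card fun l hl => mem_Iio.2 ?_
    exact (opener C).lt_iff_lt.1 ((mem_filter.1 hl).2.trans_le h)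
  · intro h
    rw [height, ← Nat.succ_le_iff, Nat.succ_eq_add_one, ← Fin.card_Iic k]
    refine card_le_card fun l hl => mem_filter.2 ⟨mem_univ _, ?_⟩
    exact ((opener C).monotone (mem_Iic.1 hl)).trans_lt h

theorem height_le (i : Fin n) : height C i ≤ n :=
  (card_le_univ _).trans_eq (Fintype.card_fin n)

theorem height_monotone : Monotone (height C) := fun _ _ hij =>
  card_le_card <| monotone_filter_right _ fun _ _ hk => lt_of_lt_of_le hk ((closer C).monotone hij)

theorem crCount_arcs {σ : Equiv.Perm (Fin n)} (hσ : ∀ i, opener C (σ i) < closer C i) :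
    crCount n (arcs C σ) = boundedNoninvCount (height C) σ := by
  rw [crCount, natCard_arcs_pairs, boundedNoninvCount]
  congr 1
  ext i j
  rw [arc, arc, isCrossing_pair_iff (hσ i) (hσ j), lt_height_iff]
  simp only [OrderEmbedding.lt_iff_lt]
  tauto

theorem neCount_arcs {σ : Equiv.Perm (Fin n)} (hσ : ∀ i, opener C (σ i) < closer C i) :
    neCount n (arcs C σ) = invCount σ := by
  rw [neCount, natCard_arcs_pairs, invCount]
  congr 1
  ext i j
  rw [arc, arc, isNesting_pair_iff (hσ i) (hσ j)]
  simp only [OrderEmbedding.lt_iff_lt]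
  tauto

theorem crCount_add_neCount_add_alCount_arcs
    {σ : Equiv.Perm (Fin n)} (hσ : ∀ i, opener C (σ i) < closer C i) :
    crCount n (arcs C σ) + neCount n (arcs C σ) + alCount n (arcs C σ) =
      pairCount fun i j : Fin n => i < j := by
  classical
  rw [crCount, neCount, alCount, natCard_arcs_pairs, natCard_arcs_pairs, natCard_arcs_pairs]
  simp only [pairCount, ← sum_add_distrib]
  refine sum_congr rfl fun i _ => sum_congr rfl fun j _ => ?_
  simp only [arc, isCrossing_pair_iff (hσ i) (hσ j), isNesting_pair_iff (hσ i) (hσ j),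
    isAlignment_pair_iff (hσ i) (hσ j)]
  have h₀ : closer C i < closer C j ↔ i < j := (closer C).lt_iff_lt
  have h₁ := hσ i
  have h₂ := hσ j
  have h₃ := opener_ne_closer C (σ j) i
  have h₄ : opener C (σ i) = opener C (σ j) → closer C i = closer C j := fun h => by
    rw [σ.injective ((opener C).injective h)]
  simp only [Fin.lt_def, Fin.ext_iff, ne_eq] at *
  split_ifs <;> omega

end

/-- Every perfect matching comes from a unique set of larger endpoints and a unique permutation. -/
theorem arcs_bijective (n : ℕ) : Function.Bijective
    (fun x : Σ C : {C : Finset (Fin (2 * n)) // C.card = n},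
        {σ : Equiv.Perm (Fin n) // ∀ i, opener C (σ i) < closer C i} =>
      (⟨arcs x.1 x.2.1, isPerfectMatching_arcs x.1 x.2.1⟩ : {M // IsPerfectMatching n M})) := by
  constructor
  · rintro ⟨C, σ, hσ⟩ ⟨D, τ, hτ⟩ h
    replace h : arcs C σ = arcs D τ := congrArg Subtype.val h
    obtain rfl : C = D := Subtype.ext <| Finset.ext fun y => by
      rw [mem_iff_exists_pair_mem_arcs C hσ, mem_iff_exists_pair_mem_arcs D hτ, h]
    obtain rfl : σ = τ := Equiv.ext fun i => by
      have hi := (pair_mem_arcs C hσ (hσ i)).2 ⟨i, rfl, rfl⟩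
      rw [h, pair_mem_arcs C hτ (hσ i)] at hi
      obtain ⟨j, hj, hji⟩ := hi
      obtain rfl := (closer C).injective hji
      exact ((opener C).injective hj).symm
    rfl
  · rintro ⟨M, hM, hM'⟩
    have exists_partner : ∀ x, ∃ y, y ≠ x ∧ {x, y} ∈ M := fun x => by
      obtain ⟨p, ⟨hp, hx⟩, -⟩ := hM' x
      obtain ⟨a, b, hab, rfl⟩ := card_eq_two.1 (hM p hp)
      rcases mem_insert.1 hx with rfl | hx
      · exact ⟨b, hab.symm, hp⟩
      · obtain rfl := mem_singleton.1 hx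
        exact ⟨a, hab, pair_comm a x ▸ hp⟩
    choose m hm hmM using exists_partner
    have m_unique : ∀ {x y}, {x, y} ∈ M → y = m x := fun {x y} h => by
      have hxy : y ≠ x := by
        rintro rfl
        simpa using hM _ h
      have := (hM' x).unique ⟨h, by simp⟩ ⟨hmM x, by simp⟩
      have hy : y ∈ ({x, m x} : Finset _) := this ▸ (by simp)
      simpa [hxy] using hy
    have hmm : ∀ x, m (m x) = x := fun x => (m_unique (pair_comm x (m x) ▸ hmM x)).symm
    have hcompl : ({x | m x < x} : Finset (Fin (2 * n)))ᶜ = ({x | x < m x} : Finset _) := by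
      ext x
      simpa using ⟨fun h => lt_of_le_of_ne h (hm x).symm, le_of_lt⟩
    have hcard : #{x | m x < x} = n := by
      have h₁ := card_add_card_compl ({x | m x < x} : Finset (Fin (2 * n)))
      have h₂ : #{x | m x < x} = #{x | x < m x} :=
        card_nbij' m m (fun x => by simp [hmm]) (fun x => by simp [hmm])
          (fun x _ => hmm x) (fun x _ => hmm x)
      rw [hcompl, Fintype.card_fin] at h₁
      omega
    let C : {C : Finset (Fin (2 * n)) // C.card = n} := ⟨({x | m x < x} : Finset _), hcard⟩
    have hC : ∀ x, x ∈ C.1 ↔ m x < x := by simp [C]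
    have hlt : ∀ i, m (closer C i) < closer C i := fun i =>
      (hC _).1 ((mem_iff_exists_closer C).2 ⟨i, rfl⟩)
    have hopen : ∀ i, ∃ k, opener C k = m (closer C i) := fun i =>
      (notMem_iff_exists_opener C).1 fun h => by
        rw [hC, hmm] at h
        exact h.asymm (hlt i)
    choose s hs using hopen
    have hs_inj : Function.Injective s := fun i j hij => (closer C).injective <| by
      rw [← hmm (closer C i), ← hs, hij, hs, hmm]
    let σ : Equiv.Perm (Fin n) := Equiv.ofBijective s (Finite.injective_iff_bijective.1 hs_inj)
    have hσ : ∀ i, opener C (σ i) = m (closer C i) := hs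
    have mem_arcs : ∀ x, m x < x → {x, m x} ∈ arcs C σ := fun x hx => by
      obtain ⟨i, rfl⟩ := (mem_iff_exists_closer C).1 ((hC x).2 hx)
      rw [pair_comm, ← hσ]
      exact mem_image_of_mem (arc C σ) (mem_univ i)
    refine ⟨⟨C, σ, fun i => hσ i ▸ hlt i⟩,
      Subtype.ext (Finset.ext fun p => ⟨fun hp => ?_, fun hp => ?_⟩)⟩
    · obtain ⟨i, -, rfl⟩ := mem_image.1 hp
      rw [arc, hσ, pair_comm]
      exact hmM _
    · obtain ⟨a, b, hab, rfl⟩ := card_eq_two.1 (hM p hp)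
      obtain rfl := m_unique hp
      rcases hab.lt_or_gt with h | h
      · have := mem_arcs (m a) (by rwa [hmm])
        rwa [hmm, pair_comm] at this
      · exact mem_arcs a h

/-- Some involution of the perfect matchings exchanges crossings and nestings and preserves
alignments. -/
theorem exists_involution_swap_crossing_nesting (n : ℕ) :
    ∃ Ψ : {M // IsPerfectMatching n M} → {M // IsPerfectMatching n M}, Function.Involutive Ψ ∧
      ∀ M, crCount n (Ψ M) = neCount n M ∧ neCount n (Ψ M) = crCount n M ∧
        alCount n (Ψ M) = alCount n M := by
  choose Φ hΦ hΦ' using fun C : {C : Finset (Fin (2 * n)) // C.card = n} =>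
    exists_involution_swap_inv (height C) (height_le C) (height_monotone C)
  simp only [lt_height_iff] at hΦ'
  let e := Equiv.ofBijective _ (arcs_bijective n)
  let X := Σ C : {C : Finset (Fin (2 * n)) // C.card = n},
    {σ : Equiv.Perm (Fin n) // ∀ i, opener C (σ i) < closer C i}
  let F : X → X := fun x =>
    ⟨x.1, ⟨Φ x.1 x.2.1, (hΦ' x.1 x.2.1 x.2.2).1⟩⟩
  have hF : Function.Involutive F := by
    rintro ⟨C, σ, hσ⟩
    simp [F, hΦ C σ]
  have hne : ∀ x, neCount n (e (F x)) = crCount n (e x) := by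
    rintro ⟨C, σ, hσ⟩
    have h := hΦ' C σ hσ
    exact (neCount_arcs C h.1).trans (h.2.trans (crCount_arcs C hσ).symm)
  have hcr : ∀ x, crCount n (e (F x)) = neCount n (e x) := fun x => by
    rw [← hne, hF]
  refine ⟨fun M => e (F (e.symm M)), fun M => by simp [hF _], fun M => ?_⟩
  obtain ⟨x, rfl⟩ := e.surjective M
  simp only [e.symm_apply_apply]
  refine ⟨hcr x, hne x, ?_⟩
  have h₁ := crCount_add_neCount_add_alCount_arcs x.1 x.2.2
  have h₂ := crCount_add_neCount_add_alCount_arcs (F x).1 (F x).2.2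
  have h₃ := hcr x
  have h₄ := hne x
  simp only [e, Equiv.ofBijective_apply] at h₃ h₄ ⊢
  omega

/-- The joint distribution of `(cr, ne, al)` over perfect matchings of `[2n]` is symmetric
under exchanging crossings and nestings: for all `a b c`, the number of matchings with
`cr = a`, `ne = b`, `al = c` equals the number with `cr = b`, `ne = a`, `al = c`. -/
theorem joint_distribution_symmetric (n a b c : ℕ) :
    Nat.card {M : Finset (Finset (Fin (2 * n))) // IsPerfectMatching n M ∧
        crCount n M = a ∧ neCount n M = b ∧ alCount n M = c} =
      Nat.card {M : Finset (Finset (Fin (2 * n))) // IsPerfectMatching n M ∧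
        crCount n M = b ∧ neCount n M = a ∧ alCount n M = c} := by
  obtain ⟨Ψ, hΨ, h⟩ := exists_involution_swap_crossing_nesting n
  let Q (a b : ℕ) (M : Finset (Finset (Fin (2 * n)))) : Prop :=
    crCount n M = a ∧ neCount n M = b ∧ alCount n M = c
  have e : {M : {M // IsPerfectMatching n M} // Q a b M} ≃
      {M : {M // IsPerfectMatching n M} // Q b a M} := (hΨ.toPerm Ψ).subtypeEquiv fun M => by
    obtain ⟨h₁, h₂, h₃⟩ := h M
    simp only [Q, Function.Involutive.coe_toPerm, h₁, h₂, h₃]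
    tauto
  exact Nat.card_congr <|
    (Equiv.subtypeSubtypeEquivSubtypeInter (IsPerfectMatching n) (Q a b)).symm.trans <|
      e.trans (Equiv.subtypeSubtypeEquivSubtypeInter (IsPerfectMatching n) (Q b a))
end

section
/- Young's lattice is a differential poset: let V be the rational vector space with basis the set of all integer partitions, and define linear operators U, D: V → V by U(μ) = Σ_{μ ⋖ ν} ν and D(μ) = Σ_{ν ⋖ μ} ν. Then DU − UD = I, the identity operator on V. -/
open scoped Classical

/-- `ν` covers `μ` in Young's lattice: the Young diagram of `ν` is obtained from that of `μ`
by adding one box. -/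
def YCov (μ ν : YoungDiagram) : Prop := μ ≤ ν ∧ ν.card = μ.card + 1

namespace YoungDiagram

theorem yCov_iff_exists_insert {μ ν : YoungDiagram} :
    YCov μ ν ↔ ∃ c ∉ μ, insert c μ.cells = ν.cells := by
  rw [YCov, ← cells_subset_iff, eq_comm (a := ν.card), ← Finset.exists_eq_insert_iff]
  rfl

/-- The Young diagram with the given set of cells, or the empty one if this is not a lower set. -/
noncomputable def ofCells (s : Finset (ℕ × ℕ)) : YoungDiagram :=
  if h : IsLowerSet (s : Set (ℕ × ℕ)) then ⟨s, h⟩ else ⊥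

theorem cells_ofCells {s : Finset (ℕ × ℕ)} (h : IsLowerSet (s : Set (ℕ × ℕ))) :
    (ofCells s).cells = s := by
  simp [ofCells, h]

theorem ofCells_cells (μ : YoungDiagram) : ofCells μ.cells = μ :=
  YoungDiagram.ext (cells_ofCells μ.isLowerSet)

/-- The rows of `μ` from which a box can be removed. -/
def removableRows (μ : YoungDiagram) : Finset ℕ :=
  (Finset.range (μ.colLen 0)).filter fun i => μ.rowLen (i + 1) < μ.rowLen i

theorem mem_removableRows {μ : YoungDiagram} {i : ℕ} :
    i ∈ μ.removableRows ↔ μ.rowLen (i + 1) < μ.rowLen i := by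
  rw [removableRows, Finset.mem_filter, Finset.mem_range, ← mem_iff_lt_colLen, mem_iff_lt_rowLen]
  lia

/-- The rows of `μ` to which a box can be added. -/
def addableRows (μ : YoungDiagram) : Finset ℕ :=
  insert 0 (μ.removableRows.map ⟨Nat.succ, Nat.succ_injective⟩)

theorem card_addableRows (μ : YoungDiagram) :
    μ.addableRows.card = μ.removableRows.card + 1 := by
  rw [addableRows, Finset.card_insert_of_notMem (by simp), Finset.card_map]

theorem succ_mem_addableRows {μ : YoungDiagram} {i : ℕ} :
    i + 1 ∈ μ.addableRows ↔ μ.rowLen (i + 1) < μ.rowLen i := by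
  simp [addableRows, mem_removableRows]

theorem isLowerSet_insert {μ : YoungDiagram} {i : ℕ} (hi : i ∈ μ.addableRows) :
    IsLowerSet ((insert (i, μ.rowLen i) μ.cells : Finset (ℕ × ℕ)) : Set (ℕ × ℕ)) := by
  rintro ⟨a, b⟩ ⟨a', b'⟩ ⟨ha : a' ≤ a, hb : b' ≤ b⟩ h
  simp only [Finset.mem_coe, Finset.mem_insert, mem_cells, Prod.mk.injEq] at h ⊢
  rcases h with ⟨rfl, rfl⟩ | h
  · rcases ha.eq_or_lt with rfl | ha
    · rw [mem_iff_lt_rowLen]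
      lia
    · obtain ⟨k, rfl⟩ := Nat.exists_eq_succ_of_ne_zero (Nat.ne_zero_of_lt ha)
      have := succ_mem_addableRows.1 hi
      have := μ.rowLen_anti a' k (by lia)
      rw [mem_iff_lt_rowLen]
      lia
  · exact .inr (μ.up_left_mem ha hb h)

theorem isLowerSet_erase {μ : YoungDiagram} {i : ℕ} (hi : i ∈ μ.removableRows) :
    IsLowerSet (μ.cells.erase (i, μ.rowLen i - 1) : Set (ℕ × ℕ)) := by
  rintro ⟨a, b⟩ ⟨a', b'⟩ ⟨ha : a' ≤ a, hb : b' ≤ b⟩ h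
  rw [mem_removableRows] at hi
  simp only [Finset.mem_coe, Finset.mem_erase, mem_cells, ne_eq, Prod.mk.injEq] at h ⊢
  refine ⟨?_, μ.up_left_mem ha hb h.2⟩
  rintro ⟨rfl, rfl⟩
  obtain ⟨h₁, h₂⟩ := h
  rw [mem_iff_lt_rowLen] at h₂
  rcases ha.eq_or_lt with rfl | ha
  · lia
  · have := μ.rowLen_anti (a' + 1) a ha
    lia

theorem yCov_iff_exists_addableRows {μ ν : YoungDiagram} :
    YCov μ ν ↔ ∃ i ∈ μ.addableRows, ofCells (insert (i, μ.rowLen i) μ.cells) = ν := by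
  rw [yCov_iff_exists_insert]
  constructor
  · rintro ⟨⟨a, b⟩, hc, h⟩
    have mem : ∀ x, x ∈ ν ↔ x = (a, b) ∨ x ∈ μ := fun x => by
      rw [← mem_cells, ← h, Finset.mem_insert, mem_cells]
    have hcν : (a, b) ∈ ν := (mem _).2 (.inl rfl)
    rw [mem_iff_lt_rowLen, not_lt] at hc
    obtain rfl : b = μ.rowLen a := by
      have := (mem _).1 (ν.up_left_mem le_rfl hc hcν)
      simpa [mem_iff_lt_rowLen, eq_comm] using this
    refine ⟨a, ?_, by rw [h, ofCells_cells]⟩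
    cases a with
    | zero => simp [addableRows]
    | succ k =>
      rw [succ_mem_addableRows, ← mem_iff_lt_rowLen]
      simpa using (mem _).1 (ν.up_left_mem k.le_succ le_rfl hcν)
  · rintro ⟨i, hi, rfl⟩
    exact ⟨(i, μ.rowLen i), by simp [mem_iff_lt_rowLen], (cells_ofCells (isLowerSet_insert hi)).symm⟩

theorem yCov_iff_exists_removableRows {μ ν : YoungDiagram} :
    YCov ν μ ↔ ∃ i ∈ μ.removableRows, ofCells (μ.cells.erase (i, μ.rowLen i - 1)) = ν := by
  rw [yCov_iff_exists_insert]
  constructor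
  · rintro ⟨⟨a, b⟩, hc, h⟩
    have mem : ∀ x, x ∈ μ ↔ x = (a, b) ∨ x ∈ ν := fun x => by
      rw [← mem_cells, ← h, Finset.mem_insert, mem_cells]
    have hcμ : b < μ.rowLen a := mem_iff_lt_rowLen.1 ((mem _).2 (.inl rfl))
    have right : ¬ b + 1 < μ.rowLen a := fun hb => by
      rw [← mem_iff_lt_rowLen, mem] at hb
      exact hc (ν.up_left_mem le_rfl b.le_succ (by simpa using hb))
    have below : ¬ b < μ.rowLen (a + 1) := fun hb => by
      rw [← mem_iff_lt_rowLen, mem] at hb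
      exact hc (ν.up_left_mem a.le_succ le_rfl (by simpa using hb))
    refine ⟨a, mem_removableRows.2 (by lia), ?_⟩
    rw [show μ.rowLen a - 1 = b by lia, ← h, Finset.erase_insert hc, ofCells_cells]
  · rintro ⟨i, hi, rfl⟩
    have hpos := mem_removableRows.1 hi
    refine ⟨(i, μ.rowLen i - 1), ?_, ?_⟩
    · rw [← mem_cells, cells_ofCells (isLowerSet_erase hi)]
      simp
    · rw [cells_ofCells (isLowerSet_erase hi), Finset.insert_erase]
      rw [mem_cells, mem_iff_lt_rowLen]
      lia

theorem card_eq_card_addableRows {μ : YoungDiagram} {s : Finset YoungDiagram}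
    (hs : ∀ ν, ν ∈ s ↔ YCov μ ν) : s.card = μ.addableRows.card := by
  have : s = μ.addableRows.image fun i => ofCells (insert (i, μ.rowLen i) μ.cells) := by
    ext ν
    rw [hs, yCov_iff_exists_addableRows, Finset.mem_image]
  rw [this, Finset.card_image_of_injOn]
  intro i hi j hj hij
  have h := congrArg cells hij
  simp only [cells_ofCells (isLowerSet_insert hi), cells_ofCells (isLowerSet_insert hj)] at h
  exact congrArg Prod.fst ((Finset.insert_inj (by simp [mem_iff_lt_rowLen])).1 h)

theorem card_eq_card_removableRows {μ : YoungDiagram} {s : Finset YoungDiagram}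
    (hs : ∀ ν, ν ∈ s ↔ YCov ν μ) : s.card = μ.removableRows.card := by
  have : s = μ.removableRows.image fun i => ofCells (μ.cells.erase (i, μ.rowLen i - 1)) := by
    ext ν
    rw [hs, yCov_iff_exists_removableRows, Finset.mem_image]
  rw [this, Finset.card_image_of_injOn]
  intro i hi j hj hij
  have h := congrArg cells hij
  simp only [cells_ofCells (isLowerSet_erase hi), cells_ofCells (isLowerSet_erase hj)] at h
  have hpos := mem_removableRows.1 hi
  refine congrArg Prod.fst ((Finset.erase_inj _ ?_).1 h)
  rw [mem_cells, mem_iff_lt_rowLen]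
  lia

theorem card_sup_add_card_inf (μ ν : YoungDiagram) :
    (μ ⊔ ν).card + (μ ⊓ ν).card = μ.card + ν.card :=
  Finset.card_union_add_card_inter _ _

theorem eq_of_le_of_card_le {μ ν : YoungDiagram} (h : μ ≤ ν) (hc : ν.card ≤ μ.card) : μ = ν :=
  YoungDiagram.ext (Finset.eq_of_subset_of_card_le h hc)

theorem card_lt_card_sup {μ ν : YoungDiagram} (hne : μ ≠ ν) (hc : μ.card = ν.card) :
    μ.card < (μ ⊔ ν).card := by
  by_contra! h
  have h₁ := eq_of_le_of_card_le (le_sup_left : μ ≤ μ ⊔ ν) h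
  have h₂ := eq_of_le_of_card_le (le_sup_right : ν ≤ μ ⊔ ν) (hc ▸ h)
  exact hne (h₁.trans h₂.symm)

theorem yCov_and_yCov_iff_eq_sup {μ ν κ : YoungDiagram} (hne : μ ≠ ν) :
    YCov μ κ ∧ YCov ν κ ↔ κ = μ ⊔ ν ∧ μ.card = ν.card ∧ (μ ⊔ ν).card = μ.card + 1 := by
  constructor
  · rintro ⟨⟨h₁, c₁⟩, h₂, c₂⟩
    have hc : μ.card = ν.card := by lia
    have := card_lt_card_sup hne hc
    have := eq_of_le_of_card_le (sup_le h₁ h₂) (by lia)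
    exact ⟨this.symm, hc, this ▸ c₁⟩
  · rintro ⟨rfl, h₁, h₂⟩
    exact ⟨⟨le_sup_left, h₂⟩, le_sup_right, by lia⟩

theorem yCov_and_yCov_iff_eq_inf {μ ν κ : YoungDiagram} (hne : μ ≠ ν) :
    YCov κ μ ∧ YCov κ ν ↔ κ = μ ⊓ ν ∧ μ.card = ν.card ∧ (μ ⊔ ν).card = μ.card + 1 := by
  have hadd := card_sup_add_card_inf μ ν
  constructor
  · rintro ⟨⟨h₁, c₁⟩, h₂, c₂⟩
    have hc : μ.card = ν.card := by lia
    have := card_lt_card_sup hne hc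
    have := eq_of_le_of_card_le (le_inf h₁ h₂) (by lia)
    subst this
    exact ⟨rfl, hc, by lia⟩
  · rintro ⟨rfl, h₁, h₂⟩
    exact ⟨⟨inf_le_left, by lia⟩, inf_le_right, by lia⟩

end YoungDiagram

/-- The coordinates of a composite of two operators with `0`-`1` matrices. -/
theorem Finsupp.comp_single_one_apply {α : Type*} {R S : α → α → Prop}
    {A B : Module.End ℚ (α →₀ ℚ)}
    (hA : ∀ a b, A (single a 1) b = if R a b then 1 else 0)
    (hB : ∀ a b, B (single a 1) b = if S a b then 1 else 0) (a b : α) :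
    (A * B) (single a 1) b = ((B (single a 1)).support.filter fun c => R c b).card := by
  have h : B (single a 1) = ∑ c ∈ (B (single a 1)).support, single c 1 := by
    conv_lhs => rw [← Finsupp.sum_single (B (single a 1)), Finsupp.sum]
    refine Finset.sum_congr rfl fun c hc => ?_
    rw [Finsupp.mem_support_iff, hB] at hc
    rw [hB, if_pos (by simpa using hc)]
  rw [Module.End.mul_apply]
  conv_lhs => rw [h]
  rw [map_sum, Finsupp.finsetSum_apply, Finset.sum_congr rfl fun c _ => hA c b, Finset.sum_boole]

/-- **Young's lattice is a differential poset.**  Let `V` be the `ℚ`-vector space with basis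
the set of all partitions (Young diagrams), and let `U, D : V → V` be the linear operators
determined by `U(μ) = Σ_{μ ⋖ ν} ν` and `D(μ) = Σ_{ν ⋖ μ} ν` (stated here as: `U`, `D` are any
linear endomorphisms whose values on basis vectors have these coordinates).  Then
`DU - UD = I`. -/
theorem young_differential_poset
    (U D : Module.End ℚ (YoungDiagram →₀ ℚ))
    (hU : ∀ μ ν : YoungDiagram, U (Finsupp.single μ 1) ν = if YCov μ ν then 1 else 0)
    (hD : ∀ μ ν : YoungDiagram, D (Finsupp.single μ 1) ν = if YCov ν μ then 1 else 0) :
    D * U - U * D = 1 := by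
  have memU : ∀ μ ν, ν ∈ (U (Finsupp.single μ 1)).support ↔ YCov μ ν := by simp [hU]
  have memD : ∀ μ ν, ν ∈ (D (Finsupp.single μ 1)).support ↔ YCov ν μ := by simp [hD]
  refine Finsupp.lhom_ext' fun μ => LinearMap.ext_ring (Finsupp.ext fun ν => ?_)
  simp only [LinearMap.comp_apply, Finsupp.lsingle_apply, LinearMap.sub_apply, Finsupp.sub_apply,
    Module.End.one_apply]
  rw [Finsupp.comp_single_one_apply hD hU, Finsupp.comp_single_one_apply hU hD]
  by_cases hne : μ = ν
  · subst hne
    rw [Finset.filter_true_of_mem fun κ => (memU μ κ).1,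
      Finset.filter_true_of_mem fun κ => (memD μ κ).1,
      YoungDiagram.card_eq_card_addableRows (memU μ),
      YoungDiagram.card_eq_card_removableRows (memD μ), YoungDiagram.card_addableRows]
    simp
  · rw [Finsupp.single_eq_of_ne' hne, sub_eq_zero, Nat.cast_inj]
    by_cases h : μ.card = ν.card ∧ (μ ⊔ ν).card = μ.card + 1
    · trans 1
      · refine Finset.card_eq_one.2 ⟨μ ⊔ ν, Finset.ext fun κ => ?_⟩
        rw [Finset.mem_filter, memU, YoungDiagram.yCov_and_yCov_iff_eq_sup hne,
          Finset.mem_singleton, and_iff_left h]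
      · refine (Finset.card_eq_one.2 ⟨μ ⊓ ν, Finset.ext fun κ => ?_⟩).symm
        rw [Finset.mem_filter, memD, YoungDiagram.yCov_and_yCov_iff_eq_inf hne,
          Finset.mem_singleton, and_iff_left h]
    · rw [Finset.filter_false_of_mem, Finset.filter_false_of_mem]
      · exact fun κ hκ hκν =>
          h ((YoungDiagram.yCov_and_yCov_iff_eq_inf hne).1 ⟨(memD μ κ).1 hκ, hκν⟩).2
      · exact fun κ hκ hκν =>
          h ((YoungDiagram.yCov_and_yCov_iff_eq_sup hne).1 ⟨(memU μ κ).1 hκ, hκν⟩).2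
end
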